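/- arXiv:1709.08724 — 2 statements merged into one kernel-verified Lean document; each statement's English description precedes it below -/
import Mathlib

section
/- Let n ≥ 2, let a₁, …, a_k be distinct points of ℝⁿ, and let f : ℝⁿ \ {a₁, …, a_k} → ℝⁿ be a continuous, open, and discrete map. Suppose f extends to a branched cover of the one-point compactification with poles exactly at a₁, …, a_k and ∞: there exists a continuous, open, and discrete map F : OnePoint ℝⁿ → OnePoint ℝⁿ such that F(x) = f(x) for every x ∈ ℝⁿ \ {a₁, …, a_k} and F⁻¹({∞}) = {∞, a₁, …, a_k}. Then there exists a radius r₀ > 0 such that there is no continuous, open, and discrete map g : ℝⁿ \ {a₂, …, a_k} → ℝⁿ that agrees with f on the set ℝⁿ \ (B(a₁, r₀) ∪ {a₂, …, a_k}), where B(a₁, r₀) is the open ball of radius r₀ centered at a₁. -/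
open Set Topology Metric

/-- `f` restricts to a homeomorphism from an open neighbourhood of `x` onto an open set:
there is a partial homeomorphism (whose source and target are open, and which is a
homeomorphism from its source onto its target) whose source contains `x` and which
agrees with `f` on its source. -/
def IsLocalHomeomorphAt {X Y : Type*} [TopologicalSpace X] [TopologicalSpace Y]
    (f : X → Y) (x : X) : Prop :=
  ∃ e : PartialHomeomorph X Y, x ∈ e.source ∧ Set.EqOn f e e.source

/-- The branch set of `f`: the set of points where `f` fails to be a local homeomorphism. -/
def branchSet {X Y : Type*} [TopologicalSpace X] [TopologicalSpace Y] (f : X → Y) : Set X :=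
  {x | ¬ IsLocalHomeomorphAt f x}

/-- A branched cover: a continuous, open and discrete map. -/
def IsBranchedCover {X Y : Type*} [TopologicalSpace X] [TopologicalSpace Y] (f : X → Y) : Prop :=
  Continuous f ∧ IsOpenMap f ∧ ∀ y : Y, DiscreteTopology ↥(f ⁻¹' {y})

theorem max_princ_aux {E : Type*} [NormedAddCommGroup E] [NormedSpace ℝ E] [ProperSpace E]
    [Nontrivial E] (s : Set E)
    (g : {x : E // x ∉ s} → E)
    (hg : Continuous g) (hgo : IsOpenMap g) (c : E) (ρ : ℝ)
    (hρs : Metric.closedBall c ρ ⊆ sᶜ) (x : {x : E // x ∉ s})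
    (hx : x.1 ∈ Metric.closedBall c ρ) :
    ∃ z : {x : E // x ∉ s}, dist z.1 c = ρ ∧ ‖g x‖ ≤ ‖g z‖ := by
  have hK : IsCompact ((fun y : {x : E // x ∉ s} => y.1) ⁻¹' Metric.closedBall c ρ) := by
    refine Topology.IsInducing.subtypeVal.isCompact_preimage' (isCompact_closedBall _ _) ?_
    intro y hy
    exact ⟨⟨y, hρs hy⟩, rfl⟩
  have hgn : Continuous fun y => ‖g y‖ := hg.norm
  obtain ⟨z, hzK, hz'⟩ := hK.exists_isMaxOn ⟨x, Set.mem_preimage.2 hx⟩ hgn.continuousOn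
  have hz : ∀ y : {x : E // x ∉ s}, y.1 ∈ Metric.closedBall c ρ → ‖g y‖ ≤ ‖g z‖ :=
    fun y hy => isMaxOn_iff.1 hz' y (Set.mem_preimage.2 hy)
  have hzK' : z.1 ∈ Metric.closedBall c ρ := Set.mem_preimage.1 hzK
  clear hz' hzK
  refine ⟨z, ?_, hz x hx⟩
  by_contra hcon
  have hzb : z.1 ∈ Metric.ball c ρ :=
    Metric.mem_ball.2 (lt_of_le_of_ne (Metric.mem_closedBall.1 hzK') hcon)
  have hopen := hgo ((fun y : {x : E // x ∉ s} => y.1) ⁻¹' Metric.ball c ρ)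
    (Metric.isOpen_ball.preimage continuous_subtype_val)
  have hsub : g '' ((fun y : {x : E // x ∉ s} => y.1) ⁻¹' Metric.ball c ρ) ⊆
      Metric.closedBall 0 ‖g z‖ := by
    rintro _ ⟨y, hy, rfl⟩
    have := hz y (Metric.ball_subset_closedBall (Set.mem_preimage.1 hy))
    exact mem_closedBall_zero_iff.2 this
  have hint := interior_maximal hsub hopen (Set.mem_image_of_mem g (Set.mem_preimage.2 hzb))
  rw [interior_closedBall'] at hint
  exact lt_irrefl _ (mem_ball_zero_iff.1 hint)

open OnePoint in
theorem stmt4 (n : ℕ) (hn : 2 ≤ n) (k : ℕ)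
    (a : Fin (k + 1) → EuclideanSpace ℝ (Fin n)) (ha : Function.Injective a)
    (f : {x : EuclideanSpace ℝ (Fin n) // x ∉ Set.range a} → EuclideanSpace ℝ (Fin n))
    (hf : IsBranchedCover f)
    (F : OnePoint (EuclideanSpace ℝ (Fin n)) → OnePoint (EuclideanSpace ℝ (Fin n)))
    (hF : IsBranchedCover F)
    (hagree : ∀ (x : EuclideanSpace ℝ (Fin n)) (hx : x ∉ Set.range a), F ↑x = ↑(f ⟨x, hx⟩))
    (hpoles : F ⁻¹' {∞} =
      {∞} ∪ (fun x : EuclideanSpace ℝ (Fin n) => (↑x : OnePoint (EuclideanSpace ℝ (Fin n)))) ''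
        Set.range a) :
    ∃ r₀ > (0 : ℝ),
      ¬ ∃ g : {x : EuclideanSpace ℝ (Fin n) // x ∉ Set.range (a ∘ Fin.succ)} →
            EuclideanSpace ℝ (Fin n),
          IsBranchedCover g ∧
          ∀ (x : EuclideanSpace ℝ (Fin n)) (hx : x ∉ Set.range a)
            (hx' : x ∉ Set.range (a ∘ Fin.succ)),
            x ∉ Metric.ball (a 0) r₀ → g ⟨x, hx'⟩ = f ⟨x, hx⟩ := by
  classical
  have : Nonempty (Fin n) := ⟨⟨0, by omega⟩⟩
  have hcl : IsClosed (Set.range (a ∘ Fin.succ)) := (Set.finite_range _).isClosed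
  have h0 : a 0 ∉ Set.range (a ∘ Fin.succ) := by
    rintro ⟨i, hi⟩
    exact Fin.succ_ne_zero i (ha hi)
  obtain ⟨ρ, hρ, hρs⟩ := (Metric.nhds_basis_closedBall.mem_iff).1 (hcl.isOpen_compl.mem_nhds h0)
  have hmem : ∀ x, x ≠ a 0 → x ∉ Set.range (a ∘ Fin.succ) → x ∉ Set.range a := by
    rintro x hx hx' ⟨i, rfl⟩
    rcases Fin.eq_zero_or_eq_succ i with rfl | ⟨j, rfl⟩
    · exact hx rfl
    · exact hx' ⟨j, rfl⟩
  -- bound on the sphere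
  have hKs : IsCompact ((Subtype.val : {x // x ∉ Set.range a} → _) ⁻¹' Metric.sphere (a 0) ρ) := by
    refine Topology.IsInducing.subtypeVal.isCompact_preimage' (isCompact_sphere _ _) ?_
    intro x hx
    refine ⟨⟨x, hmem x ?_ (hρs (Metric.sphere_subset_closedBall hx))⟩, rfl⟩
    rintro rfl
    simp at hx
    exact hρ.ne hx
  obtain ⟨C, hC⟩ := hKs.exists_bound_of_continuousOn hf.1.continuousOn
  set M := max C 0 with hM
  -- a point with large value
  have hFa : F (a 0) = ∞ := by
    have : ((a 0 : EuclideanSpace ℝ (Fin n)) : OnePoint (EuclideanSpace ℝ (Fin n))) ∈ F ⁻¹' {∞} := by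
      rw [hpoles]
      exact Or.inr ⟨a 0, ⟨0, rfl⟩, rfl⟩
    exact this
  have hV : IsOpen (((↑) '' Metric.closedBall (0 : EuclideanSpace ℝ (Fin n)) M :
      Set (OnePoint (EuclideanSpace ℝ (Fin n))))ᶜ) :=
    OnePoint.isOpen_compl_image_coe.2 ⟨Metric.isClosed_closedBall, isCompact_closedBall _ _⟩
  have hW := hV.preimage (hF.1.comp OnePoint.continuous_coe)
  have hW' := hW.mem_nhds (x := a 0) (by simp [hFa])
  have hev : ∀ᶠ x in 𝓝[≠] (a 0), x ≠ a 0 ∧ x ∈ Metric.ball (a 0) ρ ∧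
      F x ∉ ((↑) '' Metric.closedBall (0 : EuclideanSpace ℝ (Fin n)) M :
      Set (OnePoint (EuclideanSpace ℝ (Fin n)))) := by
    filter_upwards [self_mem_nhdsWithin, mem_nhdsWithin_of_mem_nhds (Metric.ball_mem_nhds _ hρ),
      mem_nhdsWithin_of_mem_nhds hW'] with x h1 h2 h3
    exact ⟨h1, h2, h3⟩
  obtain ⟨x, hx1, hx2, hx3⟩ := hev.exists
  have hxs := hρs (Metric.ball_subset_closedBall hx2)
  have hxa := hmem x hx1 hxs
  rw [hagree x hxa] at hx3
  have hfx : M < ‖f ⟨x, hxa⟩‖ := by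
    by_contra hcon
    exact hx3 ⟨_, by simpa using hcon, rfl⟩
  refine ⟨dist x (a 0), dist_pos.2 hx1, ?_⟩
  rintro ⟨g, hg, hgf⟩
  have hgx : g ⟨x, hxs⟩ = f ⟨x, hxa⟩ := hgf x hxa hxs (by simp)
  obtain ⟨z, hzb, hzx⟩ := max_princ_aux _ g hg.1 hg.2.1 (a 0) ρ hρs ⟨x, hxs⟩
    (Metric.ball_subset_closedBall hx2)
  rw [hgx] at hzx
  have hza : z.1 ∉ Set.range a := by
    refine hmem _ ?_ z.2
    intro h
    rw [h, dist_self] at hzb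
    exact hρ.ne hzb
  have h1 : g z = f ⟨z.1, hza⟩ := hgf z.1 hza z.2 (by
    rw [Metric.mem_ball, hzb, not_lt]
    exact le_of_lt hx2)
  have h2 := hC ⟨z.1, hza⟩ hzb
  rw [← h1] at h2
  exact absurd (hzx.trans (h2.trans (le_max_left C 0))) (not_le.2 hfx)
end

section
/- Let X be a compact topological space, Y a Hausdorff topological space, and g : X → Y a continuous open map. Let U ⊆ X be open and let B ⊆ Y be an open connected set such that g(frontier(U)) ∩ B = ∅ and g(U) ∩ B ≠ ∅. Then B ⊆ g(U). -/
open Set Topology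

theorem stmt6 {X Y : Type*} [TopologicalSpace X] [TopologicalSpace Y]
    [CompactSpace X] [T2Space Y]
    (g : X → Y) (hc : Continuous g) (ho : IsOpenMap g)
    (U : Set X) (hU : IsOpen U)
    (B : Set Y) (hB : IsOpen B) (hBconn : IsConnected B)
    (hfront : g '' frontier U ∩ B = ∅)
    (hmeet : (g '' U ∩ B).Nonempty) :
    B ⊆ g '' U := by
  have hcl : IsClosed (g '' closure U) := (isClosed_closure.isCompact.image hc).isClosed
  refine hBconn.isPreconnected.subset_of_closure_inter_subset (ho U hU)
    (by rwa [inter_comm]) ?_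
  rintro y ⟨hy, hyB⟩
  obtain ⟨x, hx, rfl⟩ := closure_minimal (image_mono subset_closure) hcl hy
  by_cases hxU : x ∈ U
  · exact ⟨x, hxU, rfl⟩
  · have hxf : x ∈ frontier U := ⟨hx, by rwa [hU.interior_eq]⟩
    have h : g x ∈ g '' frontier U ∩ B := ⟨⟨x, hxf, rfl⟩, hyB⟩
    rw [hfront] at h
    exact h.elim
end
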